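/- Let l be a positive integer and let A and B be real l×l positive definite matrices. Then l + ln(det A / det B) − tr(B⁻¹ A) ≤ 0, with equality if and only if A = B. -/

import Mathlib

open Matrix

theorem Matrix.PosDef.exists_isUnit_star_mul_self {n : Type*} [Fintype n] [DecidableEq n]
    {M : Matrix n n ℝ} (hM : M.PosDef) : ∃ C : Matrix n n ℝ, IsUnit C ∧ M = star C * C := by
  open scoped MatrixOrder Matrix.Norms.L2Operator in
  exact CStarAlgebra.isStrictlyPositive_iff_eq_star_mul_self.mp hM.isStrictlyPositive

theorem Matrix.PosDef.log_det_eq_sum_log_eigenvalues {n : Type*} [Fintype n] [DecidableEq n]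
    {M : Matrix n n ℝ} (hM : M.PosDef) :
    Real.log M.det = ∑ i, Real.log (hM.1.eigenvalues i) := by
  rw [hM.1.det_eq_prod_eigenvalues]
  exact Real.log_prod fun i _ => (hM.eigenvalues_pos i).ne'

theorem Matrix.IsHermitian.eq_one_of_eigenvalues_eq_one {n : Type*} [Fintype n] [DecidableEq n]
    {M : Matrix n n ℝ} (hM : M.IsHermitian) (h : ∀ i, hM.eigenvalues i = 1) : M = 1 := by
  have hdiag : diagonal (RCLike.ofReal ∘ hM.eigenvalues) = (1 : Matrix n n ℝ) := by
    rw [← diagonal_one]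
    congr 1
    ext i
    simp [h i]
  rw [hM.spectral_theorem, hdiag, map_one]

theorem Matrix.PosDef.log_det_le_trace_sub_card {n : Type*} [Fintype n] [DecidableEq n]
    {M : Matrix n n ℝ} (hM : M.PosDef) : Real.log M.det ≤ M.trace - Fintype.card n := by
  have htr : M.trace - Fintype.card n = ∑ i, (hM.1.eigenvalues i - 1) := by
    simp [hM.1.trace_eq_sum_eigenvalues, Finset.sum_sub_distrib]
  rw [hM.log_det_eq_sum_log_eigenvalues, htr]
  exact Finset.sum_le_sum fun i _ => Real.log_le_sub_one_of_pos (hM.eigenvalues_pos i)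

theorem Matrix.PosDef.log_det_eq_trace_sub_card_iff {n : Type*} [Fintype n] [DecidableEq n]
    {M : Matrix n n ℝ} (hM : M.PosDef) :
    Real.log M.det = M.trace - Fintype.card n ↔ M = 1 := by
  refine ⟨fun h => ?_, fun h => by simp [h]⟩
  have htr : M.trace - Fintype.card n = ∑ i, (hM.1.eigenvalues i - 1) := by
    simp [hM.1.trace_eq_sum_eigenvalues, Finset.sum_sub_distrib]
  rw [hM.log_det_eq_sum_log_eigenvalues, htr, Finset.sum_eq_sum_iff_of_le
    fun i _ => Real.log_le_sub_one_of_pos (hM.eigenvalues_pos i)] at h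
  refine hM.1.eq_one_of_eigenvalues_eq_one fun i => ?_
  by_contra hi
  exact (Real.log_lt_sub_one_of_pos (hM.eigenvalues_pos i) hi).ne (h i (Finset.mem_univ i))

theorem stmt_0 (l : ℕ) (hl : 0 < l) (A B : Matrix (Fin l) (Fin l) ℝ)
    (hA : A.PosDef) (hB : B.PosDef) :
    (l : ℝ) + Real.log (A.det / B.det) - (B⁻¹ * A).trace ≤ 0 ∧
      ((l : ℝ) + Real.log (A.det / B.det) - (B⁻¹ * A).trace = 0 ↔ A = B) := by
  obtain ⟨C, hC, hBC⟩ := hB.inv.exists_isUnit_star_mul_self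
  have hM : (C * A * star C).PosDef := (IsUnit.posDef_star_right_conjugate_iff hC).mpr hA
  have htrace : (B⁻¹ * A).trace = (C * A * star C).trace := by
    rw [hBC, trace_mul_comm (C * A), Matrix.mul_assoc]
  have hdet : A.det / B.det = (C * A * star C).det := by
    have hinv : (star C).det * C.det = B.det⁻¹ := by
      rw [← det_mul, ← hBC, det_nonsing_inv, Ring.inverse_eq_inv']
    rw [det_mul, det_mul, div_eq_mul_inv, ← hinv]
    ring
  have hone : C * A * star C = 1 ↔ A = B := by
    rw [Matrix.mul_assoc, mul_eq_one_comm, Matrix.mul_assoc, ← hBC]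
    have hBdet : IsUnit B.det := hB.det_pos.ne'.isUnit
    constructor
    · intro h
      rw [← nonsing_inv_nonsing_inv B hBdet]
      exact (inv_eq_left_inv h).symm
    · rintro rfl
      exact mul_nonsing_inv A hBdet
  have hle := hM.log_det_le_trace_sub_card
  have heq := hM.log_det_eq_trace_sub_card_iff
  rw [Fintype.card_fin] at hle heq
  rw [htrace, hdet, ← hone, ← heq]
  exact ⟨by linarith, fun h => by linarith, fun h => by linarith⟩
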